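/- Let d = 3. Then lim_{β̃ → ∞} β̃^{5/2} ∫_{[−π,π]³} (ε(k)/(e^{β̃ ε(k)} − 1)) d³k/(2π)³ = (3/2) π^{3/2} ζ(5/2)/(2π)³. Consequently, the first-order spin-wave interaction correction satisfies lim_{β̃ → ∞} β̃^5 · (1/12) ( ∫_{[−π,π]³} (ε(k)/(e^{β̃ ε(k)} − 1)) d³k/(2π)³ )² = (3/(128 (2π)³)) ζ(5/2)², matching the coefficient in Dyson's low-temperature expansion at order S^{−1}. -/

import Mathlib

open Real MeasureTheory Filter

/-- The spin-wave dispersion relation `ε(k) = ∑_{j=1}^3 2(1 − cos k_j)` in dimension 3. -/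
noncomputable def spinWaveEps3 (k : Fin 3 → ℝ) : ℝ :=
  ∑ j, 2 * (1 - Real.cos (k j))

/-- The Bose function `y / (e^y - 1)` is dominated by `e^{-y/2}` on the nonnegative half-line. -/
lemma div_exp_sub_one_le_exp_neg_half {y : ℝ} (hy : 0 ≤ y) :
    y / (Real.exp y - 1) ≤ Real.exp (-(y / 2)) := by
  rcases hy.eq_or_lt with rfl | hpos
  · simp
  · have hden : 0 < Real.exp y - 1 := by linarith [Real.add_one_le_exp y]
    rw [div_le_iff₀ hden]
    have hsinh : y / 2 ≤ Real.sinh (y / 2) := Real.self_le_sinh_iff.2 (by positivity)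
    rw [Real.sinh_eq] at hsinh
    have hexp : Real.exp (-(y / 2)) * Real.exp y = Real.exp (y / 2) := by
      rw [← Real.exp_add]; ring_nf
    linarith [mul_sub (Real.exp (-(y / 2))) (Real.exp y) 1]

lemma div_exp_sub_one_nonneg {y : ℝ} (hy : 0 ≤ y) : 0 ≤ y / (Real.exp y - 1) :=
  div_nonneg hy (by linarith [Real.add_one_le_exp y])

/-- Expansion of the Bose function in Boltzmann factors. -/
lemma hasSum_mul_exp_neg_nat_succ_mul {y : ℝ} (hy : 0 ≤ y) :
    HasSum (fun n : ℕ => y * Real.exp (-((n : ℝ) + 1) * y)) (y / (Real.exp y - 1)) := by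
  rcases hy.eq_or_lt with rfl | hpos
  · simp
  · have hlt : Real.exp (-y) < 1 := by simpa using hpos
    have hgeom := (hasSum_geometric_of_lt_one (Real.exp_pos (-y)).le hlt).mul_left
      (y * Real.exp (-y))
    have hden : Real.exp y - 1 ≠ 0 := by linarith [Real.add_one_le_exp y]
    have hval : y * Real.exp (-y) * (1 - Real.exp (-y))⁻¹ = y / (Real.exp y - 1) := by
      rw [Real.exp_neg]
      have := Real.exp_pos y
      have h : (1 - (Real.exp y)⁻¹) = (Real.exp y - 1) / Real.exp y := by field_simp
      rw [h]
      field_simp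
    rw [hval] at hgeom
    have hterm (n : ℕ) : y * Real.exp (-y) * Real.exp (-y) ^ n =
        y * Real.exp (-((n : ℝ) + 1) * y) := by
      rw [mul_assoc, ← Real.exp_nat_mul, ← Real.exp_add]
      ring_nf
    simpa only [hterm] using hgeom

lemma integrable_sq_mul_exp_neg_mul_sq {a : ℝ} (ha : 0 < a) :
    Integrable fun t : ℝ => t ^ 2 * Real.exp (-a * t ^ 2) := by
  simpa using integrable_rpow_mul_exp_neg_mul_sq ha (s := 2) (by norm_num)

lemma integral_sq_mul_exp_neg_mul_sq {a : ℝ} (ha : 0 < a) :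
    ∫ t : ℝ, t ^ 2 * Real.exp (-a * t ^ 2) = √(π / a) / (2 * a) := by
  have habs := integral_comp_abs (f := fun t : ℝ => t ^ 2 * Real.exp (-a * t ^ 2))
  simp only [sq_abs] at habs
  have hIoi := integral_rpow_mul_exp_neg_mul_rpow (p := 2) (q := 2) two_pos (by norm_num) ha
  simp only [Real.rpow_two] at hIoi
  rw [habs, hIoi]
  have hGamma : Real.Gamma ((2 + 1) / 2) = √π / 2 := by
    rw [show ((2 : ℝ) + 1) / 2 = 1 / 2 + 1 by norm_num, Real.Gamma_add_one (by norm_num),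
      Real.Gamma_one_half_eq]
    ring
  have hpow : a ^ (-((2 : ℝ) + 1) / 2) = (a * √a)⁻¹ := by
    rw [show -((2 : ℝ) + 1) / 2 = -(1 + 1 / 2) by norm_num, Real.rpow_neg ha.le,
      Real.rpow_add ha, Real.rpow_one, ← Real.sqrt_eq_rpow]
  rw [hGamma, hpow, Real.sqrt_div' _ ha.le]
  have := Real.sqrt_pos.2 ha
  field_simp

/-- The `j`-th summand of `|x|² e^{-a|x|²}` factorizes over coordinates. -/
lemma sq_coord_mul_exp_eq_prod (a : ℝ) (j : Fin 3) (x : Fin 3 → ℝ) :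
    x j ^ 2 * Real.exp (-a * ∑ i, x i ^ 2) =
      ∏ i, (if i = j then fun t : ℝ => t ^ 2 * Real.exp (-a * t ^ 2)
        else fun t : ℝ => Real.exp (-a * t ^ 2)) (x i) := by
  rw [Finset.mul_sum, Real.exp_sum]
  fin_cases j <;> simp [Fin.prod_univ_three] <;> ring

lemma integrable_sq_coord_mul_exp {a : ℝ} (ha : 0 < a) (j : Fin 3) :
    Integrable fun x : Fin 3 → ℝ => x j ^ 2 * Real.exp (-a * ∑ i, x i ^ 2) := by
  simp_rw [sq_coord_mul_exp_eq_prod a j]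
  refine Integrable.fintype_prod fun i => ?_
  split_ifs
  · exact integrable_sq_mul_exp_neg_mul_sq ha
  · exact integrable_exp_neg_mul_sq ha

lemma integral_sq_coord_mul_exp {a : ℝ} (ha : 0 < a) (j : Fin 3) :
    ∫ x : Fin 3 → ℝ, x j ^ 2 * Real.exp (-a * ∑ i, x i ^ 2) = √(π / a) ^ 3 / (2 * a) := by
  simp_rw [sq_coord_mul_exp_eq_prod a j]
  rw [integral_fintype_prod_volume_eq_prod]
  have hone := integral_sq_mul_exp_neg_mul_sq ha
  have hzero := integral_gaussian a
  fin_cases j <;> simp [Fin.prod_univ_three] at hone hzero ⊢ <;> rw [hone, hzero] <;> ring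

lemma integrable_sum_sq_mul_exp {a : ℝ} (ha : 0 < a) :
    Integrable fun x : Fin 3 → ℝ => (∑ i, x i ^ 2) * Real.exp (-a * ∑ i, x i ^ 2) := by
  simp_rw [Finset.sum_mul]
  exact integrable_finsetSum _ fun j _ => integrable_sq_coord_mul_exp ha j

lemma integral_sum_sq_mul_exp {a : ℝ} (ha : 0 < a) :
    ∫ x : Fin 3 → ℝ, (∑ i, x i ^ 2) * Real.exp (-a * ∑ i, x i ^ 2) =
      3 / 2 * π ^ ((3 : ℝ) / 2) * a ^ (-(5 : ℝ) / 2) := by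
  simp_rw [Finset.sum_mul]
  rw [integral_finsetSum _ fun j _ => integrable_sq_coord_mul_exp ha j]
  simp_rw [integral_sq_coord_mul_exp ha]
  have hpi : π ^ ((3 : ℝ) / 2) = √π ^ 3 := by
    rw [Real.sqrt_eq_rpow, ← Real.rpow_natCast, ← Real.rpow_mul Real.pi_pos.le]
    norm_num
  have hpow : a ^ (-(5 : ℝ) / 2) = (a * √a ^ 3)⁻¹ := by
    rw [Real.sqrt_eq_rpow, ← Real.rpow_natCast, ← Real.rpow_mul ha.le,
      show -(5 : ℝ) / 2 = -(1 + 1 / 2 * (3 : ℕ)) by norm_num, Real.rpow_neg ha.le,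
      Real.rpow_add ha, Real.rpow_one]
  rw [hpi, hpow, Real.sqrt_div' _ ha.le]
  have := Real.sqrt_pos.2 ha
  simp
  field_simp

lemma integral_sum_sq_div_exp_sub_one :
    ∫ x : Fin 3 → ℝ, (∑ i, x i ^ 2) / (Real.exp (∑ i, x i ^ 2) - 1) =
      3 / 2 * π ^ ((3 : ℝ) / 2) * ∑' n : ℕ, ((n : ℝ) + 1) ^ (-(5 : ℝ) / 2) := by
  have hsq (x : Fin 3 → ℝ) : 0 ≤ ∑ i, x i ^ 2 := Finset.sum_nonneg fun i _ => sq_nonneg _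
  have hsum : Summable fun n : ℕ => ((n : ℝ) + 1) ^ (-(5 : ℝ) / 2) := by
    have h := (summable_nat_add_iff 1).2
      (Real.summable_nat_rpow (p := -(5 : ℝ) / 2).2 (by norm_num))
    simpa using h
  have hint := hasSum_integral_of_summable_integral_norm
    (F := fun (n : ℕ) (x : Fin 3 → ℝ) =>
      (∑ i, x i ^ 2) * Real.exp (-((n : ℝ) + 1) * ∑ i, x i ^ 2))
    (μ := volume) (fun n => integrable_sum_sq_mul_exp (by positivity)) (by
      have hnorm (n : ℕ) (x : Fin 3 → ℝ) :
          ‖(∑ i, x i ^ 2) * Real.exp (-((n : ℝ) + 1) * ∑ i, x i ^ 2)‖ =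
            (∑ i, x i ^ 2) * Real.exp (-((n : ℝ) + 1) * ∑ i, x i ^ 2) :=
        Real.norm_of_nonneg (mul_nonneg (hsq x) (Real.exp_pos _).le)
      simp_rw [hnorm]
      refine (hsum.mul_left (3 / 2 * π ^ ((3 : ℝ) / 2))).congr fun n => ?_
      exact (integral_sum_sq_mul_exp (a := (n : ℝ) + 1) (by positivity)).symm)
  rw [← tsum_mul_left]
  have hterm (n : ℕ) := integral_sum_sq_mul_exp (a := (n : ℝ) + 1) (by positivity)
  simp_rw [hterm, (hasSum_mul_exp_neg_nat_succ_mul (hsq _)).tsum_eq] at hint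
  exact hint.tsum_eq.symm

lemma spinWaveEps3_nonneg (k : Fin 3 → ℝ) : 0 ≤ spinWaveEps3 k :=
  Finset.sum_nonneg fun j _ => by linarith [Real.cos_le_one (k j)]

lemma continuous_spinWaveEps3 : Continuous spinWaveEps3 := by
  unfold spinWaveEps3
  fun_prop

/-- Quadratic lower bound of the dispersion relation on the Brillouin zone. -/
lemma sum_sq_le_spinWaveEps3 {k : Fin 3 → ℝ}
    (hk : k ∈ Set.univ.pi fun _ : Fin 3 => Set.Icc (-π) π) :
    4 / π ^ 2 * ∑ j, k j ^ 2 ≤ spinWaveEps3 k := by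
  rw [spinWaveEps3, Finset.mul_sum]
  refine Finset.sum_le_sum fun j _ => ?_
  have h := Real.cos_le_one_sub_mul_cos_sq (abs_le.2 (hk j trivial))
  have h4 : 4 / π ^ 2 * k j ^ 2 = 2 * (2 / π ^ 2 * k j ^ 2) := by ring
  linarith

/-- The dispersion relation becomes quadratic in the long-wavelength limit. -/
lemma tendsto_mul_spinWaveEps3_inv_sqrt_smul (x : Fin 3 → ℝ) :
    Tendsto (fun b : ℝ => b * spinWaveEps3 ((√b)⁻¹ • x)) atTop (nhds (∑ j, x j ^ 2)) := by
  simp only [spinWaveEps3, Finset.mul_sum]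
  refine tendsto_finsetSum _ fun j _ => ?_
  have hinv : Tendsto (fun b : ℝ => (√b)⁻¹ * x j / 2) atTop (nhds 0) := by
    simpa using ((tendsto_inv_atTop_zero.comp Real.tendsto_sqrt_atTop).mul_const (x j)).div_const 2
  have hsinc := (((Real.continuous_sinc.tendsto 0).comp hinv).pow 2).const_mul (x j ^ 2)
  simp only [Real.sinc_zero, one_pow, mul_one] at hsinc
  refine hsinc.congr' ?_
  filter_upwards [eventually_gt_atTop 0] with b hb
  have hsqrt := Real.sqrt_pos.2 hb
  simp only [Function.comp_apply, Pi.smul_apply, smul_eq_mul]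
  have hcos : 1 - Real.cos ((√b)⁻¹ * x j) = 2 * Real.sin ((√b)⁻¹ * x j / 2) ^ 2 := by
    have h := Real.cos_two_mul' ((√b)⁻¹ * x j / 2)
    rw [mul_div_cancel₀ _ two_ne_zero] at h
    linarith [Real.sin_sq_add_cos_sq ((√b)⁻¹ * x j / 2)]
  rw [hcos]
  rcases eq_or_ne (x j) 0 with hx | hx
  · simp [hx]
  · rw [Real.sinc_of_ne_zero (by positivity)]
    nth_rewrite 3 [← Real.sq_sqrt hb.le]
    field_simp

/-- Rescaling the momentum by `√b` in the Brillouin-zone integral. -/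
lemma rpow_mul_setIntegral_eq_integral_indicator {b : ℝ} (hb : 0 < b) :
    b ^ ((5 : ℝ) / 2) * ∫ k in Set.univ.pi fun _ : Fin 3 => Set.Icc (-π) π,
        spinWaveEps3 k / (Real.exp (b * spinWaveEps3 k) - 1) =
      ∫ x : Fin 3 → ℝ, (Set.univ.pi fun _ : Fin 3 => Set.Icc (-π) π).indicator
        (fun k => b * spinWaveEps3 k / (Real.exp (b * spinWaveEps3 k) - 1)) ((√b)⁻¹ • x) := by
  have hsqrt := Real.sqrt_pos.2 hb
  have hmeas : MeasurableSet (Set.univ.pi fun _ : Fin 3 => Set.Icc (-π) π) :=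
    MeasurableSet.univ_pi fun _ => measurableSet_Icc
  rw [Measure.integral_comp_smul, integral_indicator hmeas]
  simp_rw [mul_div_assoc]
  rw [integral_const_mul, smul_eq_mul, ← mul_assoc]
  congr 1
  have hpow : b ^ ((5 : ℝ) / 2) = √b ^ 3 * b := by
    rw [Real.sqrt_eq_rpow, ← Real.rpow_natCast, ← Real.rpow_mul hb.le, ← Real.rpow_add_one hb.ne']
    norm_num
  rw [hpow, Module.finrank_fin_fun, inv_pow, inv_inv, abs_of_pos (by positivity)]

lemma tendsto_rpow_mul_setIntegral_spinWaveEps3 :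
    Tendsto (fun b : ℝ => b ^ ((5 : ℝ) / 2) *
        ∫ k in Set.univ.pi fun _ : Fin 3 => Set.Icc (-π) π,
          spinWaveEps3 k / (Real.exp (b * spinWaveEps3 k) - 1))
      atTop
      (nhds (3 / 2 * π ^ ((3 : ℝ) / 2) * ∑' n : ℕ, ((n : ℝ) + 1) ^ (-(5 : ℝ) / 2))) := by
  rw [← integral_sum_sq_div_exp_sub_one]
  have hmeas : MeasurableSet (Set.univ.pi fun _ : Fin 3 => Set.Icc (-π) π) :=
    MeasurableSet.univ_pi fun _ => measurableSet_Icc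
  refine Tendsto.congr' ((eventually_gt_atTop 0).mono fun b hb =>
    (rpow_mul_setIntegral_eq_integral_indicator hb).symm) ?_
  refine tendsto_integral_filter_of_dominated_convergence
    (fun x => ∏ i, Real.exp (-(2 / π ^ 2) * x i ^ 2)) ?_ ?_ ?_ ?_
  · refine Eventually.of_forall fun b => Measurable.aestronglyMeasurable ?_
    have heps := continuous_spinWaveEps3.measurable
    exact Measurable.comp (Measurable.indicator (by fun_prop) hmeas) (by fun_prop)
  · filter_upwards [eventually_gt_atTop 0] with b hb
    refine Eventually.of_forall fun x => ?_
    rw [← Real.exp_sum]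
    by_cases hx : (√b)⁻¹ • x ∈ Set.univ.pi fun _ : Fin 3 => Set.Icc (-π) π
    · have heps : 0 ≤ b * spinWaveEps3 ((√b)⁻¹ • x) :=
        mul_nonneg hb.le (spinWaveEps3_nonneg _)
      rw [Set.indicator_of_mem hx, Real.norm_of_nonneg (div_exp_sub_one_nonneg heps)]
      refine (div_exp_sub_one_le_exp_neg_half heps).trans (Real.exp_le_exp.2 ?_)
      have hlow := mul_le_mul_of_nonneg_left (sum_sq_le_spinWaveEps3 hx) hb.le
      have hscale : b * (4 / π ^ 2 * ∑ j, ((√b)⁻¹ • x) j ^ 2) = 4 / π ^ 2 * ∑ j, x j ^ 2 := by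
        simp only [Pi.smul_apply, smul_eq_mul, mul_pow, inv_pow, Real.sq_sqrt hb.le,
          ← Finset.mul_sum]
        field_simp
      rw [hscale] at hlow
      rw [← Finset.mul_sum]
      have htwo : -(2 / π ^ 2) * ∑ j, x j ^ 2 = -(4 / π ^ 2 * ∑ j, x j ^ 2) / 2 := by ring
      linarith
    · rw [Set.indicator_of_notMem hx, norm_zero]
      positivity
  · exact Integrable.fintype_prod fun _ => integrable_exp_neg_mul_sq (by positivity)
  · filter_upwards [Measure.ae_ne volume (0 : Fin 3 → ℝ)] with x hx
    have hpos : 0 < ∑ i, x i ^ 2 := by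
      obtain ⟨j, hj⟩ := Function.ne_iff.1 hx
      exact Finset.sum_pos' (fun i _ => sq_nonneg _) ⟨j, Finset.mem_univ j, by
        have : x j ≠ 0 := hj
        positivity⟩
    have hlim := tendsto_mul_spinWaveEps3_inv_sqrt_smul x
    have hden : Real.exp (∑ i, x i ^ 2) - 1 ≠ 0 := by
      linarith [Real.add_one_le_exp (∑ i, x i ^ 2)]
    refine (hlim.div (((Real.continuous_exp.tendsto _).comp hlim).sub_const 1) hden).congr' ?_
    have hzero : Tendsto (fun b : ℝ => (√b)⁻¹ • x) atTop (nhds 0) := by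
      simpa using (tendsto_inv_atTop_zero.comp Real.tendsto_sqrt_atTop).smul_const x
    have hnhds : (Set.univ.pi fun _ : Fin 3 => Set.Icc (-π) π) ∈ nhds (0 : Fin 3 → ℝ) :=
      set_pi_mem_nhds Set.finite_univ fun _ _ =>
        Icc_mem_nhds (neg_lt_zero.2 Real.pi_pos) Real.pi_pos
    filter_upwards [hzero.eventually_mem hnhds] with b hb
    rw [Set.indicator_of_mem hb]
    rfl

/-- in `d = 3`,
`β̃^{5/2} ∫_{[−π,π]³} ε(k)/(e^{β̃ε(k)}−1) d³k/(2π)³ → (3/2)π^{3/2}ζ(5/2)/(2π)³` as `β̃ → ∞`,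
and consequently the first-order spin-wave interaction correction satisfies
`β̃^5 (1/12)(∫_{[−π,π]³} ε(k)/(e^{β̃ε(k)}−1) d³k/(2π)³)² → (3/(128(2π)³)) ζ(5/2)²`,
matching Dyson's low-temperature expansion at order `S^{−1}`
(here `ζ(5/2) = ∑_{n=1}^∞ n^{−5/2}`). -/
theorem first_order_correction_matches_Dyson :
    Tendsto (fun b : ℝ => b ^ ((5 : ℝ) / 2) *
        ((1 / (2 * π) ^ 3) *
          ∫ k in Set.univ.pi fun _ : Fin 3 => Set.Icc (-π) π,
            spinWaveEps3 k / (Real.exp (b * spinWaveEps3 k) - 1)))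
      atTop
      (nhds ((3 / 2) * π ^ ((3 : ℝ) / 2) *
        (∑' n : ℕ, ((n : ℝ) + 1) ^ (-(5 : ℝ) / 2)) / (2 * π) ^ 3)) ∧
    Tendsto (fun b : ℝ => b ^ (5 : ℕ) * (1 / 12) *
        ((1 / (2 * π) ^ 3) *
          ∫ k in Set.univ.pi fun _ : Fin 3 => Set.Icc (-π) π,
            spinWaveEps3 k / (Real.exp (b * spinWaveEps3 k) - 1)) ^ 2)
      atTop
      (nhds (3 / (128 * (2 * π) ^ 3) *
        (∑' n : ℕ, ((n : ℝ) + 1) ^ (-(5 : ℝ) / 2)) ^ 2)) := by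
  have hmain := tendsto_rpow_mul_setIntegral_spinWaveEps3.const_mul (1 / (2 * π) ^ 3)
  have hfirst := hmain.congr fun b => mul_left_comm _ _ _
  rw [one_div_mul_eq_div] at hfirst
  refine ⟨hfirst, ?_⟩
  have hsq := (hfirst.pow 2).const_mul (1 / 12)
  have hpi : (π ^ ((3 : ℝ) / 2)) ^ 2 = π ^ 3 := by
    rw [← Real.rpow_natCast, ← Real.rpow_mul Real.pi_pos.le, ← Real.rpow_natCast]
    norm_num
  convert hsq.congr' ?_ using 2
  · rw [div_pow, mul_pow (3 / 2 * _), mul_pow (3 / 2) (π ^ ((3 : ℝ) / 2)), hpi]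
    field_simp
    ring
  · filter_upwards [eventually_ge_atTop 0] with b hb
    have hpow : (b ^ ((5 : ℝ) / 2)) ^ 2 = b ^ 5 := by
      rw [← Real.rpow_natCast, ← Real.rpow_mul hb, ← Real.rpow_natCast]
      norm_num
    rw [mul_pow, hpow]
    ring
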